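/- Let U_1, …, U_r be a GRPE family, b_k(x) = ⟨x e_{n(x)}ᵀ, U_k⟩, and let p* ∈ ℝ^r define the concept c(x) = ∑_{k=1}^r p*_k·b_k(x). Suppose p : [0,∞) → ℝ^r is differentiable, p(0) = 0, and for all t ≥ 0 and all k, p'(t)_k = −2^{−N0}·∑_{x ∈ X_{N0}} (∑_{l=1}^r p(t)_l·b_l(x) − c(x))·b_k(x) (gradient flow on the ℓ2 loss over the uniform distribution on X_{N0}). If p(t) converges to some p̂ ∈ ℝ^r as t → ∞ and ∑_{k=1}^r p̂_k·b_k(x) = c(x) for all x ∈ X_{N0}, then for every p' ∈ ℝ^r with ∑_{k=1}^r p'_k·b_k(x) = c(x) for all x ∈ X_{N0}, one has p̂_k² ≤ p'_k² for all k = 1, …, r. -/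

import Mathlib

open Finset Matrix

noncomputable section

def toVec {N : ℕ} (σ : Fin N → Bool) : Fin N → ℝ := fun i => if σ i then 1 else -1

def cubeLow (N N0 : ℕ) : Finset (Fin N → Bool) :=
  Finset.univ.filter (fun σ => ∀ i : Fin N, N0 ≤ (i : ℕ) → σ i = true)

def nIdx {N : ℕ} (σ : Fin N → Bool) : ℕ :=
  Finset.univ.sup (fun i : Fin N => if σ i then 0 else (i : ℕ) + 1)

def eVec (N : ℕ) (k : ℕ) : Fin N → ℝ := fun i => if (i : ℕ) + 1 = k then 1 else 0

def outer {N : ℕ} (σ : Fin N → Bool) : Matrix (Fin N) (Fin N) ℝ :=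
  Matrix.of fun i j => toVec σ i * eVec N (nIdx σ) j

def frobInner {N : ℕ} (A B : Matrix (Fin N) (Fin N) ℝ) : ℝ :=
  ∑ i, ∑ j, A i j * B i j

def maskU (N : ℕ) : Matrix (Fin N) (Fin N) ℝ :=
  Matrix.of fun i j => if i ≤ j then 1 else 0

def bPLAA {N : ℕ} (i j : Fin N) (σ : Fin N → Bool) : ℝ :=
  (if i = j then -1 else toVec σ i) * ((1 - toVec σ j) / 2) *
    ∏ k ∈ Finset.univ.filter (fun k : Fin N => j < k), (1 + toVec σ k) / 2


/-- A GRPE family: upper triangular matrices of unit Frobenius norm with disjoint supports. -/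
def GRPEFamily (N r : ℕ) (U : Fin r → Matrix (Fin N) (Fin N) ℝ) : Prop :=
  (∀ m : Fin r, ∀ i j : Fin N, j < i → U m i j = 0) ∧
  (∀ m : Fin r, frobInner (U m) (U m) = 1) ∧
  (∀ m m' : Fin r, m ≠ m' → ∀ i j : Fin N, U m i j * U m' i j = 0)

/-- `b_k(x) = ⟨x e_{n(x)}ᵀ, U_k⟩`. -/
def bfun {N r : ℕ} (U : Fin r → Matrix (Fin N) (Fin N) ℝ) (k : Fin r)
    (σ : Fin N → Bool) : ℝ :=
  frobInner (outer σ) (U k)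

/-- Only the column of index `n(x) - 1` of `V` contributes to `⟨x e_{n(x)}ᵀ, V⟩`. -/
theorem frobInner_outer_of_nIdx {N : ℕ} (σ : Fin N → Bool) (V : Matrix (Fin N) (Fin N) ℝ)
    (j : Fin N) (h : nIdx σ = (j : ℕ) + 1) :
    frobInner (outer σ) V = ∑ i, toVec σ i * V i j := by
  unfold frobInner outer eVec
  refine Finset.sum_congr rfl fun i _ => ?_
  rw [Finset.sum_eq_single j]
  · simp [h]
  · intro b _ hb
    have : (b : ℕ) ≠ j := fun h' => hb (Fin.ext h')
    simp [h, this]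
  · simp

theorem nIdx_le_of_mem_cubeLow {N N0 : ℕ} {σ : Fin N → Bool} (hσ : σ ∈ cubeLow N N0) :
    nIdx σ ≤ N0 := by
  unfold nIdx
  refine Finset.sup_le fun i _ => ?_
  have hi := (Finset.mem_filter.mp hσ).2 i
  split_ifs with h
  · exact Nat.zero_le _
  · by_contra hc
    exact h (hi (by omega))

/-- The sum `∑ k, q k * b_k` is the functional attached to the matrix `∑ k, q k • U k`. -/
theorem sum_mul_bfun {N r : ℕ} (U : Fin r → Matrix (Fin N) (Fin N) ℝ) (q : Fin r → ℝ)
    (σ : Fin N → Bool) :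
    ∑ k, q k * bfun U k σ = frobInner (outer σ) (Matrix.of fun i j => ∑ k, q k * U k i j) := by
  simp only [bfun, frobInner, Finset.mul_sum, Matrix.of_apply]
  rw [Finset.sum_comm]
  refine Finset.sum_congr rfl fun i _ => ?_
  rw [Finset.sum_comm]
  refine Finset.sum_congr rfl fun j _ => Finset.sum_congr rfl fun k _ => ?_
  ring

/-- The point of the cube whose coordinates equal to `-1` are exactly `i` and `j`. -/
def pairPoint {N : ℕ} (i j : Fin N) : Fin N → Bool := fun m => decide (m ≠ i ∧ m ≠ j)

theorem pairPoint_mem_cubeLow {N N0 : ℕ} {i j : Fin N} (hij : i ≤ j) (hj : (j : ℕ) < N0) :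
    pairPoint i j ∈ cubeLow N N0 := by
  refine Finset.mem_filter.mpr ⟨Finset.mem_univ _, fun m hm => ?_⟩
  have hij' : (i : ℕ) ≤ j := hij
  simp only [pairPoint, decide_eq_true_eq]
  constructor <;> rintro rfl <;> omega

theorem nIdx_pairPoint {N : ℕ} {i j : Fin N} (hij : i ≤ j) :
    nIdx (pairPoint i j) = (j : ℕ) + 1 := by
  have hij' : (i : ℕ) ≤ j := hij
  unfold nIdx
  apply le_antisymm
  · refine Finset.sup_le fun m _ => ?_
    split_ifs with h
    · exact Nat.zero_le _
    · by_contra hc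
      apply h
      simp only [pairPoint, decide_eq_true_eq]
      constructor <;> rintro rfl <;> omega
  · have := Finset.le_sup (f := fun m : Fin N => if pairPoint i j m then 0 else (m : ℕ) + 1)
      (Finset.mem_univ j)
    simpa [pairPoint] using this

theorem frobInner_outer_pairPoint_self {N : ℕ} (V : Matrix (Fin N) (Fin N) ℝ) (j : Fin N) :
    frobInner (outer (pairPoint j j)) V = ∑ m, V m j - 2 * V j j := by
  rw [frobInner_outer_of_nIdx _ _ j (nIdx_pairPoint le_rfl)]
  have h : ∀ m, toVec (pairPoint j j) m * V m j = V m j - if m = j then 2 * V m j else 0 := by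
    intro m
    by_cases hm : m = j <;> simp [toVec, pairPoint, hm]
    ring
  simp [h, Finset.sum_sub_distrib]

theorem frobInner_outer_pairPoint {N : ℕ} (V : Matrix (Fin N) (Fin N) ℝ) {i j : Fin N}
    (hij : i < j) :
    frobInner (outer (pairPoint i j)) V = ∑ m, V m j - 2 * V i j - 2 * V j j := by
  rw [frobInner_outer_of_nIdx _ _ j (nIdx_pairPoint hij.le)]
  have h : ∀ m, toVec (pairPoint i j) m * V m j =
      V m j - (if m = i then 2 * V m j else 0) - if m = j then 2 * V m j else 0 := by
    intro m
    by_cases hi : m = i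
    · subst hi
      simp [toVec, pairPoint, hij.ne]
      ring
    · by_cases hm : m = j <;> simp [toVec, pairPoint, hm, hi, hij.ne']
      ring
  simp [h, Finset.sum_sub_distrib]

/-- An upper triangular matrix is determined on its first `N0` columns by the values
`⟨x e_{n(x)}ᵀ, V⟩` for `x ∈ X_{N0}`. -/
theorem eq_zero_of_frobInner_outer_eq_zero {N N0 : ℕ} {V : Matrix (Fin N) (Fin N) ℝ}
    (hV : ∀ i j : Fin N, j < i → V i j = 0)
    (h : ∀ σ ∈ cubeLow N N0, frobInner (outer σ) V = 0) (i j : Fin N) (hj : (j : ℕ) < N0) :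
    V i j = 0 := by
  have hself := h _ (pairPoint_mem_cubeLow (le_refl j) hj)
  rw [frobInner_outer_pairPoint_self] at hself
  have hoff : ∀ m, m ≠ j → V m j = 0 := by
    intro m hm
    rcases lt_or_gt_of_ne hm with hlt | hgt
    · have := h _ (pairPoint_mem_cubeLow hlt.le hj)
      rw [frobInner_outer_pairPoint V hlt] at this
      linarith
    · exact hV m j hgt
  by_cases hij : i = j
  · subst hij
    rw [Finset.sum_eq_single i (fun m _ hm => hoff m hm) (by simp)] at hself
    linarith
  · exact hoff i hij

theorem GRPEFamily.coeff_mul_entry_eq_zero {N N0 r : ℕ} {U : Fin r → Matrix (Fin N) (Fin N) ℝ}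
    (hU : GRPEFamily N r U) {q : Fin r → ℝ}
    (hq : ∀ σ ∈ cubeLow N N0, ∑ k, q k * bfun U k σ = 0) (k : Fin r) (i j : Fin N)
    (hj : (j : ℕ) < N0) : q k * U k i j = 0 := by
  obtain ⟨htri, -, hdisj⟩ := hU
  have hsum : ∑ l, q l * U l i j = 0 :=
    eq_zero_of_frobInner_outer_eq_zero (V := Matrix.of fun i j => ∑ l, q l * U l i j)
      (fun a b hab => by simp [htri _ a b hab])
      (fun σ hσ => by rw [← sum_mul_bfun, hq σ hσ]) i j hj
  by_cases hk : U k i j = 0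
  · simp [hk]
  · rw [Finset.sum_eq_single k _ (by simp)] at hsum
    · exact hsum
    · intro l _ hl
      rw [(mul_eq_zero.mp (hdisj l k hl i j)).resolve_right hk, mul_zero]

theorem bfun_eq_zero_of_columns_eq_zero {N N0 r : ℕ} {U : Fin r → Matrix (Fin N) (Fin N) ℝ}
    {k : Fin r} (h : ∀ i j : Fin N, (j : ℕ) < N0 → U k i j = 0) {σ : Fin N → Bool}
    (hσ : σ ∈ cubeLow N N0) : bfun U k σ = 0 := by
  unfold bfun frobInner
  refine Finset.sum_eq_zero fun i _ => Finset.sum_eq_zero fun j _ => ?_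
  by_cases hj : (j : ℕ) < N0
  · rw [h i j hj, mul_zero]
  · have hne : (j : ℕ) + 1 ≠ nIdx σ := by
      have := nIdx_le_of_mem_cubeLow hσ
      omega
    simp [outer, eVec, hne]

/-- A function with zero derivative on `[0, ∞)` vanishing at `0` tends only to `0`. -/
theorem eq_zero_of_tendsto_of_hasDerivAt_zero {f : ℝ → ℝ} {a : ℝ} (h0 : f 0 = 0)
    (hf : ∀ t, 0 ≤ t → HasDerivAt f 0 t) (ha : Filter.Tendsto f Filter.atTop (nhds a)) :
    a = 0 := by
  have hzero : ∀ t, 0 ≤ t → f t = 0 := fun t ht =>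
    (constant_of_has_deriv_right_zero
      (fun x hx => (hf x hx.1).continuousAt.continuousWithinAt)
      (fun x hx => (hf x hx.1).hasDerivWithinAt) t ⟨ht, le_rfl⟩).trans h0
  refine tendsto_nhds_unique ha (tendsto_const_nhds.congr' ?_)
  filter_upwards [Filter.eventually_ge_atTop 0] with t ht
  exact (hzero t ht).symm

/-- Gradient flow on the `ℓ2` loss over `X_{N0}`, started at `0`, converges (if it converges
to an interpolator) to the coordinatewise minimal interpolator. -/
theorem grpe_gradient_flow_min (N N0 r : ℕ) (hN0 : 1 ≤ N0) (hN : N0 ≤ N)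
    (U : Fin r → Matrix (Fin N) (Fin N) ℝ) (hU : GRPEFamily N r U)
    (pstar : Fin r → ℝ)
    (p : ℝ → Fin r → ℝ) (hp0 : p 0 = 0)
    (hderiv : ∀ t : ℝ, 0 ≤ t → ∀ k : Fin r,
      HasDerivAt (fun s => p s k)
        (-(1 / 2 ^ N0 : ℝ) *
          ∑ σ ∈ cubeLow N N0,
            ((∑ l, p t l * bfun U l σ) - ∑ l, pstar l * bfun U l σ) * bfun U k σ) t)
    (phat : Fin r → ℝ) (hconv : Filter.Tendsto p Filter.atTop (nhds phat))
    (hinterp : ∀ σ ∈ cubeLow N N0,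
      (∑ k, phat k * bfun U k σ) = ∑ k, pstar k * bfun U k σ) :
    ∀ p' : Fin r → ℝ,
      (∀ σ ∈ cubeLow N N0, (∑ k, p' k * bfun U k σ) = ∑ k, pstar k * bfun U k σ) →
      ∀ k : Fin r, (phat k) ^ 2 ≤ (p' k) ^ 2 := by
  intro p' hp' k
  by_cases h : ∀ i j : Fin N, (j : ℕ) < N0 → U k i j = 0
  · have hk : phat k = 0 := by
      refine eq_zero_of_tendsto_of_hasDerivAt_zero (f := fun s => p s k) (by simp [hp0])
        (fun t ht => ?_) ((tendsto_pi_nhds.mp hconv) k)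
      have hd := hderiv t ht k
      rwa [Finset.sum_eq_zero fun σ hσ => by
        rw [bfun_eq_zero_of_columns_eq_zero h hσ, mul_zero], mul_zero] at hd
    rw [hk, zero_pow two_ne_zero]
    exact sq_nonneg _
  · push Not at h
    obtain ⟨i, j, hj, hne⟩ := h
    have hq : ∀ σ ∈ cubeLow N N0, ∑ l, (phat l - p' l) * bfun U l σ = 0 := fun σ hσ => by
      simp only [sub_mul, Finset.sum_sub_distrib]
      rw [hinterp σ hσ, hp' σ hσ, sub_self]
    have hk := (mul_eq_zero.mp (hU.coeff_mul_entry_eq_zero hq k i j hj)).resolve_right hne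
    rw [sub_eq_zero.mp hk]

end
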